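/- arXiv:1902.03339 — 2 statements merged into one kernel-verified Lean document; each statement's English description precedes it below -/
import Mathlib

section
/- For every strategy η, the worst-case cost satisfies J(η) ≥ sup over n₁ ∈ 𝒩₁ of V*_1(Π₁(n₁), n₁ᵒ). -/
noncomputable section

/-- A finite-horizon minimax control system over times `1, …, T` (0-indexed below):
state space `𝒮 = 𝒮ʰ × 𝒮ᵒ`, observations in `O`, actions in `A`, noise in `N`
(the initial noise, which is the initial state, lies in `N1 ⊆ 𝒮`). -/
structure MMSys (Sh So O A N : Type) where
  /-- Horizon. -/
  T : ℕ
  /-- Range of the initial noise `N₁ ⊆ 𝒮` (the initial state is `S₁ = N₁`). -/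
  N1 : Set (Sh × So)
  /-- Range of the noise driving the transition into (0-indexed) time `t ≥ 1`. -/
  Nt : ℕ → Set N
  /-- Dynamics: `f t` produces the state at (0-indexed) time `t ≥ 1`. -/
  f : ℕ → (Sh × So) → A → N → (Sh × So)
  /-- Initial observation function `O₁ = h₁(S₁)`. -/
  h0 : (Sh × So) → O
  /-- Observation functions: `h t` produces the observation at time `t ≥ 1`. -/
  h : ℕ → (Sh × So) → A → N → O
  /-- Admissible actions, depending on the observable part of the state. -/
  Aset : So → Set A
  /-- Instantaneous cost `ρ_t`. -/
  cost : ℕ → (Sh × So) → A → ℝ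

namespace MMSys

variable {Sh So O A N : Type} (M : MMSys Sh So O A N)

/-- Admissible noise realizations: the initial noise together with the later ones. -/
def Omega : Set ((Sh × So) × (ℕ → N)) :=
  {ω | ω.1 ∈ M.N1 ∧ ∀ t, ω.2 t ∈ M.Nt t}

/-- State trajectory induced by an action assignment. -/
def St (act : ℕ → ((Sh × So) × (ℕ → N)) → A) : ℕ → ((Sh × So) × (ℕ → N)) → Sh × So
  | 0 => fun ω => ω.1
  | t + 1 => fun ω => M.f (t + 1) (St act t ω) (act t ω) (ω.2 (t + 1))

/-- Observation trajectory induced by an action assignment. -/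
def Obs (act : ℕ → ((Sh × So) × (ℕ → N)) → A) : ℕ → ((Sh × So) × (ℕ → N)) → O
  | 0 => fun ω => M.h0 ω.1
  | t + 1 => fun ω => M.h (t + 1) (M.St act t ω) (act t ω) (ω.2 (t + 1))

/-- Two noise realizations produce the same information history
`Q_t = (O_{1:t}, S^o_{1:t}, A_{1:t−1})`. -/
def histEq (act : ℕ → ((Sh × So) × (ℕ → N)) → A) (t : ℕ)
    (ω ω' : (Sh × So) × (ℕ → N)) : Prop :=
  (∀ i ≤ t, M.Obs act i ω = M.Obs act i ω') ∧
  (∀ i ≤ t, (M.St act i ω).2 = (M.St act i ω').2) ∧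
  (∀ i < t, act i ω = act i ω')

/-- A strategy `η`: an admissible action assignment `A_t = η_t(Q_t)` which is a
function of the information history `Q_t`. -/
structure Strategy where
  /-- The action taken at time `t` on the realization `ω`. -/
  act : ℕ → ((Sh × So) × (ℕ → N)) → A
  admissible : ∀ t ω, t < M.T → ω ∈ M.Omega → act t ω ∈ M.Aset (M.St act t ω).2
  adapted : ∀ t ω ω', t < M.T → ω ∈ M.Omega → ω' ∈ M.Omega →
    M.histEq act t ω ω' → act t ω = act t ω'

/-- Worst-case maximum instantaneous cost
`J(η) = sup_{noise} max_{1 ≤ t ≤ T} ρ_t(S_t, A_t)`. -/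
def J (η : M.Strategy) : ℝ :=
  sSup {c : ℝ | ∃ ω ∈ M.Omega,
    c = ⨆ t : Fin M.T, M.cost t (M.St η.act t ω) (η.act t ω)}

/-- Updated information state `Π′` after taking action `a` at information state
`(π, so)` and observing the data generated by the hidden state `sh` and noise `nn`
(here `t` is the arrival time index). -/
def nextSet (t : ℕ) (π : Set Sh) (so : So) (a : A) (sh : Sh) (nn : N) : Set Sh :=
  {zh | ∃ z0h ∈ π, ∃ m ∈ M.Nt t,
    M.f t (z0h, so) a m = (zh, (M.f t (sh, so) a nn).2) ∧
    M.h t (z0h, so) a m = M.h t (sh, so) a nn}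

/-- Terminal inner cost `sup_{sʰ ∈ π} ρ_T((sʰ, sᵒ), a)`. -/
def termCost (π : Set Sh) (so : So) (a : A) : ℝ :=
  sSup {c : ℝ | ∃ sh ∈ π, c = M.cost (M.T - 1) (sh, so) a}

/-- Intermediate inner cost at (0-indexed) time `i`, given the value function at
the next time: `sup_{sʰ ∈ π, n ∈ 𝒩_{t+1}} max( ρ_t, V_{t+1}(Π′, (s′)ᵒ) )`. -/
def stepCost (i : ℕ) (Vnext : Set Sh → So → ℝ) (π : Set Sh) (so : So) (a : A) : ℝ :=
  sSup {c : ℝ | ∃ sh ∈ π, ∃ nn ∈ M.Nt (i + 1),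
    c = max (M.cost i (sh, so) a)
      (Vnext (M.nextSet (i + 1) π so a sh nn) ((M.f (i + 1) (sh, so) a nn).2))}

/-- Value functions, indexed by the number `k` of remaining steps
(`Vaux k` is `V*_t` for the 0-indexed time `t = T − 1 − k`). -/
def Vaux : ℕ → Set Sh → So → ℝ
  | 0 => fun π so => sInf (M.termCost π so '' M.Aset so)
  | k + 1 => fun π so => sInf (M.stepCost (M.T - 2 - k) (Vaux k) π so '' M.Aset so)

/-- `Vstar i`: value function `V*` at (0-indexed) time `i`. -/
def Vstar (i : ℕ) : Set Sh → So → ℝ := M.Vaux (M.T - 1 - i)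

/-- The inner cost minimized over actions at each stage of the recursion
defining `Vaux`. -/
def innerCost : ℕ → Set Sh → So → A → ℝ
  | 0 => M.termCost
  | k + 1 => M.stepCost (M.T - 2 - k) (M.Vaux k)

/-- Initial information state `Π₁(n₁)`. -/
def Pi1 (n1 : Sh × So) : Set Sh :=
  {zh | (zh, n1.2) ∈ M.N1 ∧ M.h0 (zh, n1.2) = M.h0 n1}

end MMSys


namespace MMSys

variable {Sh So O A N : Type} (M : MMSys Sh So O A N)

theorem histEq.symm {M : MMSys Sh So O A N} {act : ℕ → ((Sh × So) × (ℕ → N)) → A} {t : ℕ}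
    {ω ω' : (Sh × So) × (ℕ → N)} (h : M.histEq act t ω ω') : M.histEq act t ω' ω :=
  ⟨fun i hi => (h.1 i hi).symm, fun i hi => (h.2.1 i hi).symm, fun i hi => (h.2.2 i hi).symm⟩

theorem histEq.trans {M : MMSys Sh So O A N} {act : ℕ → ((Sh × So) × (ℕ → N)) → A} {t : ℕ}
    {ω₁ ω₂ ω₃ : (Sh × So) × (ℕ → N)} (h : M.histEq act t ω₁ ω₂) (h' : M.histEq act t ω₂ ω₃) :
    M.histEq act t ω₁ ω₃ :=
  ⟨fun i hi => (h.1 i hi).trans (h'.1 i hi), fun i hi => (h.2.1 i hi).trans (h'.2.1 i hi),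
    fun i hi => (h.2.2 i hi).trans (h'.2.2 i hi)⟩

theorem histEq_succ {act : ℕ → ((Sh × So) × (ℕ → N)) → A} {t : ℕ}
    {ω ω' : (Sh × So) × (ℕ → N)} :
    M.histEq act (t + 1) ω ω' ↔ M.histEq act t ω ω' ∧ act t ω = act t ω' ∧
      M.Obs act (t + 1) ω = M.Obs act (t + 1) ω' ∧
      (M.St act (t + 1) ω).2 = (M.St act (t + 1) ω').2 := by
  simp only [histEq, Nat.le_succ_iff, Nat.lt_succ_iff_lt_or_eq, or_imp, forall_and, forall_eq]
  tauto

/-- The history and the state up to time `t` depend only on the noise up to time `t`. -/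
theorem histEq_and_St_eq_of_noise_eq (η : M.Strategy) {ω ω' : (Sh × So) × (ℕ → N)}
    (hω : ω ∈ M.Omega) (hω' : ω' ∈ M.Omega) (h0 : ω.1 = ω'.1) (t : ℕ) (ht : t < M.T)
    (hn : ∀ i ≤ t, ω.2 i = ω'.2 i) :
    M.histEq η.act t ω ω' ∧ M.St η.act t ω = M.St η.act t ω' := by
  induction t with
  | zero => simp [histEq, St, Obs, h0]
  | succ t ih =>
    obtain ⟨hh, hs⟩ := ih (by omega) fun i hi => hn i (by omega)
    have ha := η.adapted t ω ω' (by omega) hω hω' hh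
    have hs' : M.St η.act (t + 1) ω = M.St η.act (t + 1) ω' := by
      simp only [St, hs, ha, hn (t + 1) le_rfl]
    refine ⟨M.histEq_succ.2 ⟨hh, ha, ?_, by rw [hs']⟩, hs'⟩
    simp only [Obs, hs, ha, hn (t + 1) le_rfl]

open Classical in
/-- Replace the noise at time `t` by `m`. -/
def updateNoise (ω : (Sh × So) × (ℕ → N)) (t : ℕ) (m : N) : (Sh × So) × (ℕ → N) :=
  (ω.1, Function.update ω.2 t m)

theorem updateNoise_mem {ω : (Sh × So) × (ℕ → N)} (hω : ω ∈ M.Omega) {t : ℕ} {m : N}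
    (hm : m ∈ M.Nt t) : updateNoise ω t m ∈ M.Omega := by
  refine ⟨hω.1, fun i => ?_⟩
  by_cases hi : i = t
  · subst hi
    simpa [updateNoise] using hm
  · simpa [updateNoise, Function.update_of_ne hi] using hω.2 i

theorem histEq_updateNoise (η : M.Strategy) {ω : (Sh × So) × (ℕ → N)} (hω : ω ∈ M.Omega)
    {t : ℕ} (ht : t < M.T) {m : N} (hm : m ∈ M.Nt (t + 1)) :
    M.histEq η.act t ω (updateNoise ω (t + 1) m) ∧
      M.St η.act t ω = M.St η.act t (updateNoise ω (t + 1) m) := by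
  refine M.histEq_and_St_eq_of_noise_eq η hω (M.updateNoise_mem hω hm) rfl t ht fun i hi => ?_
  simp [updateNoise, Function.update_of_ne (show i ≠ t + 1 by omega)]

/-- The hidden states at time `t` compatible with the history generated by `ω`. -/
def infoState (act : ℕ → ((Sh × So) × (ℕ → N)) → A) (t : ℕ) (ω : (Sh × So) × (ℕ → N)) : Set Sh :=
  {zh | ∃ ω' ∈ M.Omega, M.histEq act t ω ω' ∧ M.St act t ω' = (zh, (M.St act t ω).2)}

theorem infoState_congr {act : ℕ → ((Sh × So) × (ℕ → N)) → A} {t : ℕ}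
    {ω ω' : (Sh × So) × (ℕ → N)} (h : M.histEq act t ω ω') :
    M.infoState act t ω = M.infoState act t ω' := by
  ext zh
  simp only [infoState, Set.mem_ofPred_eq, h.2.1 t le_rfl]
  exact exists_congr fun ω₁ => and_congr_right fun _ => and_congr_left fun _ =>
    ⟨h.symm.trans, h.trans⟩

theorem infoState_zero (act : ℕ → ((Sh × So) × (ℕ → N)) → A) {ω : (Sh × So) × (ℕ → N)}
    (hω : ω ∈ M.Omega) : M.infoState act 0 ω = M.Pi1 ω.1 := by
  ext zh
  constructor
  · rintro ⟨ω', hω', hh, hs⟩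
    have hs : ω'.1 = (zh, ω.1.2) := hs
    have ho : M.h0 ω.1 = M.h0 ω'.1 := hh.1 0 le_rfl
    exact ⟨hs ▸ hω'.1, by rw [← hs, ho]⟩
  · rintro ⟨hz, ho⟩
    refine ⟨((zh, ω.1.2), ω.2), ⟨hz, hω.2⟩, ?_, rfl⟩
    simp [histEq, St, Obs, ho]

/-- The information state evolves by the set-valued filter `nextSet`. -/
theorem nextSet_infoState (η : M.Strategy) {ω : (Sh × So) × (ℕ → N)} (hω : ω ∈ M.Omega)
    {t : ℕ} (ht : t + 1 < M.T) :
    M.nextSet (t + 1) (M.infoState η.act t ω) (M.St η.act t ω).2 (η.act t ω)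
      (M.St η.act t ω).1 (ω.2 (t + 1)) = M.infoState η.act (t + 1) ω := by
  ext zh
  constructor
  · rintro ⟨z, ⟨ω₁, hω₁, hh, hs⟩, m, hm, hf, ho⟩
    obtain ⟨hh₂, hs₂⟩ := M.histEq_updateNoise η hω₁ (by omega : t < M.T) hm
    have hω₂ := M.updateNoise_mem hω₁ hm
    have hh' := hh.trans hh₂
    have ha := η.adapted t _ _ (by omega) hω hω₂ hh'
    have hn : (updateNoise ω₁ (t + 1) m).2 (t + 1) = m := by simp [updateNoise]
    have hst : M.St η.act (t + 1) (updateNoise ω₁ (t + 1) m) =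
        (zh, (M.St η.act (t + 1) ω).2) := by
      simp only [St]
      rw [hn, ← hs₂, ← ha, hs, hf]
    refine ⟨_, hω₂, M.histEq_succ.2 ⟨hh', ha, ?_, by rw [hst]⟩, hst⟩
    simp only [Obs]
    rw [hn, ← hs₂, ← ha, hs, ho]
  · rintro ⟨ω₁, hω₁, hh, hs⟩
    obtain ⟨hh', ha, ho, -⟩ := M.histEq_succ.1 hh
    have hso := hh'.2.1 t le_rfl
    have hpair : ((M.St η.act t ω₁).1, (M.St η.act t ω).2) = M.St η.act t ω₁ := by rw [hso]
    refine ⟨(M.St η.act t ω₁).1, ⟨ω₁, hω₁, hh', by rw [hso]⟩, ω₁.2 (t + 1), hω₁.2 _, ?_, ?_⟩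
    · rw [hpair]
      simpa only [St, ha] using hs
    · rw [hpair]
      simpa only [Obs, ha] using ho.symm

theorem innerCost_nonneg (hcost : ∀ t s a, 0 ≤ M.cost t s a) (k : ℕ) (π : Set Sh) (so : So)
    (a : A) : 0 ≤ M.innerCost k π so a := by
  cases k with
  | zero =>
    refine Real.sSup_nonneg ?_
    rintro _ ⟨sh, -, rfl⟩
    exact hcost _ _ _
  | succ k =>
    refine Real.sSup_nonneg ?_
    rintro _ ⟨sh, -, nn, -, rfl⟩
    exact (hcost _ _ _).trans (le_max_left _ _)

theorem Vaux_le_innerCost (hcost : ∀ t s a, 0 ≤ M.cost t s a) (k : ℕ) (π : Set Sh) {so : So}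
    {a : A} (ha : a ∈ M.Aset so) : M.Vaux k π so ≤ M.innerCost k π so a := by
  have hbdd : BddBelow (M.innerCost k π so '' M.Aset so) :=
    ⟨0, by rintro _ ⟨b, -, rfl⟩; exact M.innerCost_nonneg hcost k π so b⟩
  cases k <;> exact csInf_le hbdd ⟨a, ha, rfl⟩

theorem J_nonneg (hcost : ∀ t s a, 0 ≤ M.cost t s a) (η : M.Strategy) : 0 ≤ M.J η := by
  refine Real.sSup_nonneg ?_
  rintro _ ⟨ω, -, rfl⟩
  exact Real.iSup_nonneg fun t => hcost _ _ _

theorem cost_le_J (hcost : ∃ B, ∀ t s a, M.cost t s a ≤ B) (η : M.Strategy)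
    {ω : (Sh × So) × (ℕ → N)} (hω : ω ∈ M.Omega) {t : ℕ} (ht : t < M.T) :
    M.cost t (M.St η.act t ω) (η.act t ω) ≤ M.J η := by
  obtain ⟨B, hB⟩ := hcost
  have : Nonempty (Fin M.T) := ⟨⟨t, ht⟩⟩
  have hfin := le_ciSup (f := fun t : Fin M.T => M.cost t (M.St η.act t ω) (η.act t ω))
    (Set.finite_range _).bddAbove ⟨t, ht⟩
  refine hfin.trans (le_csSup ⟨B, ?_⟩ ⟨ω, hω, rfl⟩)
  rintro _ ⟨ω', -, rfl⟩
  exact ciSup_le fun _ => hB _ _ _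

/-- Along every realization, the value function at the current information state is at most
the worst-case cost of the strategy. -/
theorem Vaux_infoState_le_J (hnonneg : ∀ t s a, 0 ≤ M.cost t s a)
    (hbdd : ∃ B, ∀ t s a, M.cost t s a ≤ B) (η : M.Strategy) (k t : ℕ) (hkt : t + k + 1 = M.T)
    {ω : (Sh × So) × (ℕ → N)} (hω : ω ∈ M.Omega) :
    M.Vaux k (M.infoState η.act t ω) (M.St η.act t ω).2 ≤ M.J η := by
  induction k generalizing t ω with
  | zero =>
    refine (M.Vaux_le_innerCost hnonneg 0 _ (η.admissible t ω (by omega) hω)).trans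
      (Real.sSup_le ?_ (M.J_nonneg hnonneg η))
    rintro _ ⟨sh, ⟨ω', hω', hh, hs⟩, rfl⟩
    rw [← hs, show M.T - 1 = t by omega, η.adapted t ω ω' (by omega) hω hω' hh]
    exact M.cost_le_J hbdd η hω' (by omega)
  | succ k ih =>
    refine (M.Vaux_le_innerCost hnonneg (k + 1) _ (η.admissible t ω (by omega) hω)).trans
      (Real.sSup_le ?_ (M.J_nonneg hnonneg η))
    rw [show M.T - 2 - k = t by omega]
    rintro _ ⟨sh, ⟨ω', hω', hh, hs⟩, nn, hnn, rfl⟩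
    obtain ⟨hh', hs'⟩ := M.histEq_updateNoise η hω' (by omega : t < M.T) hnn
    have hω₂ := M.updateNoise_mem hω' hnn
    have hn : (updateNoise ω' (t + 1) nn).2 (t + 1) = nn := by simp [updateNoise]
    generalize updateNoise ω' (t + 1) nn = ω₂ at hh' hs' hω₂ hn
    have hs₂ : M.St η.act t ω₂ = (sh, (M.St η.act t ω).2) := hs' ▸ hs
    have ha := η.adapted t ω ω₂ (by omega) hω hω₂ (hh.trans hh')
    rw [M.infoState_congr (hh.trans hh'), ha, ← hs₂, ← hn]
    refine max_le (M.cost_le_J hbdd η hω₂ (by omega)) ?_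
    have hV := ih (t + 1) (by omega) hω₂
    rw [← M.nextSet_infoState η hω₂ (by omega)] at hV
    simpa only [hs₂, St] using hV

end MMSys


/-- for every strategy `η`,
`J(η) ≥ sup_{n₁ ∈ 𝒩₁} V*_1(Π₁(n₁), n₁ᵒ)`. -/
theorem stmt1 {Sh So O A N : Type} (M : MMSys Sh So O A N) (hT : 0 < M.T)
    (hN1 : M.N1.Nonempty) (hNt : ∀ t, (M.Nt t).Nonempty)
    (hA : ∀ so, (M.Aset so).Nonempty)
    (hcost_nonneg : ∀ t s a, 0 ≤ M.cost t s a)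
    (hcost_bdd : ∃ B, ∀ t s a, M.cost t s a ≤ B)
    (η : M.Strategy) :
    sSup {r : ℝ | ∃ n1 ∈ M.N1, r = M.Vstar 0 (M.Pi1 n1) n1.2} ≤ M.J η := by
  refine Real.sSup_le ?_ (M.J_nonneg hcost_nonneg η)
  rintro _ ⟨n₁, hn₁, rfl⟩
  choose n hn using hNt
  have hω : (n₁, n) ∈ M.Omega := ⟨hn₁, hn⟩
  have h := M.Vaux_infoState_le_J hcost_nonneg hcost_bdd η (M.T - 1) 0 (by omega) hω
  rwa [M.infoState_zero η.act hω] at h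
end
end

section
/- Fix a prescription strategy d and let y_{1:T} be an observation sequence induced by at least one noise sequence. Then for every t: (i) Π_t = {y_t} if y_t ≠ ε, and Π_t = {x ∈ Θ_t : Γ_t(x) = 0} if y_t = ε, where Γ_t = d_t(y_{1:t−1}); and (ii) for t < T, Θ_{t+1} = {λ A x + w : x ∈ Π_t, ‖w‖ ≤ a_{t+1}}. -/
noncomputable section

abbrev Euc (n : ℕ) := EuclideanSpace ℝ (Fin n)

variable {n : ℕ}

/-- Source trajectory: `X_1 = n_1`, `X_{t+1} = λ A X_t + n_{t+1}` (0-indexed). -/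
def srcX (lam : ℝ) (A : Euc n ≃ₗᵢ[ℝ] Euc n) (ν : ℕ → Euc n) : ℕ → Euc n
  | 0 => ν 0
  | t + 1 => lam • A (srcX lam A ν t) + ν (t + 1)

/-- Channel outputs induced by a prescription strategy `d` on the noise
realization `ν`: `Γ_t = d_t(Y_{1:t−1})`, `U_t = Γ_t(X_t)` and `Y_t = X_t` if
`U_t = 1`, `Y_t = ε` (i.e. `none`) if `U_t = 0`. -/
def Yd (lam : ℝ) (A : Euc n ≃ₗᵢ[ℝ] Euc n)
    (d : (t : ℕ) → (Fin t → Option (Euc n)) → Euc n → Bool)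
    (ν : ℕ → Euc n) : ℕ → Option (Euc n)
  | t =>
    if d t (fun i => Yd lam A d ν i.1) (srcX lam A ν t) then some (srcX lam A ν t)
    else none
decreasing_by all_goals exact i.2

/-- Pre-transmission conditional range `Θ_t`: values of `X_t` under noise
sequences whose induced observations at times `1, …, t−1` equal `y_{1:t−1}`. -/
def Theta (lam : ℝ) (A : Euc n ≃ₗᵢ[ℝ] Euc n) (T : ℕ) (a : ℕ → ℝ)
    (d : (t : ℕ) → (Fin t → Option (Euc n)) → Euc n → Bool)
    (y : ℕ → Option (Euc n)) (t : ℕ) : Set (Euc n) :=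
  {x | ∃ ν : ℕ → Euc n, (∀ i < T, ‖ν i‖ ≤ a i) ∧
    (∀ i < t, Yd lam A d ν i = y i) ∧ srcX lam A ν t = x}

/-- Post-transmission conditional range `Π_t`: values of `X_t` under noise
sequences whose induced observations at times `1, …, t` equal `y_{1:t}`. -/
def Pit (lam : ℝ) (A : Euc n ≃ₗᵢ[ℝ] Euc n) (T : ℕ) (a : ℕ → ℝ)
    (d : (t : ℕ) → (Fin t → Option (Euc n)) → Euc n → Bool)
    (y : ℕ → Option (Euc n)) (t : ℕ) : Set (Euc n) :=
  {x | ∃ ν : ℕ → Euc n, (∀ i < T, ‖ν i‖ ≤ a i) ∧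
    (∀ i ≤ t, Yd lam A d ν i = y i) ∧ srcX lam A ν t = x}

theorem Yd_eq (lam : ℝ) (A : Euc n ≃ₗᵢ[ℝ] Euc n)
    (d : (t : ℕ) → (Fin t → Option (Euc n)) → Euc n → Bool)
    (ν : ℕ → Euc n) (y : ℕ → Option (Euc n)) (t : ℕ)
    (h : ∀ i < t, Yd lam A d ν i = y i) :
    Yd lam A d ν t =
      if d t (fun i => y i.1) (srcX lam A ν t) then some (srcX lam A ν t) else none := by
  have hpast : (fun i : Fin t => Yd lam A d ν i.1) = fun i : Fin t => y i.1 :=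
    funext fun i => h i.1 i.2
  rw [Yd, hpast]

theorem srcX_congr (lam : ℝ) (A : Euc n ≃ₗᵢ[ℝ] Euc n) {ν ν' : ℕ → Euc n} :
    ∀ {t : ℕ}, (∀ i ≤ t, ν i = ν' i) → srcX lam A ν t = srcX lam A ν' t
  | 0, h => h 0 le_rfl
  | t + 1, h => by
    rw [srcX, srcX, srcX_congr lam A fun i hi => h i (hi.trans t.le_succ), h (t + 1) le_rfl]

theorem Yd_congr (lam : ℝ) (A : Euc n ≃ₗᵢ[ℝ] Euc n)
    (d : (t : ℕ) → (Fin t → Option (Euc n)) → Euc n → Bool) {ν ν' : ℕ → Euc n} (t : ℕ)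
    (h : ∀ i ≤ t, ν i = ν' i) : Yd lam A d ν t = Yd lam A d ν' t := by
  induction t using Nat.strong_induction_on with
  | _ t ih =>
    rw [Yd_eq lam A d ν (Yd lam A d ν') t fun i hi => ih i hi fun j hj => h j (hj.trans hi.le),
      Yd_eq lam A d ν' (Yd lam A d ν') t fun _ _ => rfl, srcX_congr lam A h]

theorem Pit_eq_singleton (lam : ℝ) (A : Euc n ≃ₗᵢ[ℝ] Euc n) {T : ℕ} {a : ℕ → ℝ}
    {d : (t : ℕ) → (Fin t → Option (Euc n)) → Euc n → Bool} {y : ℕ → Option (Euc n)}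
    (hy : ∃ ν : ℕ → Euc n, (∀ i < T, ‖ν i‖ ≤ a i) ∧ ∀ i < T, Yd lam A d ν i = y i)
    {t : ℕ} (ht : t < T) {v : Euc n} (hv : y t = some v) : Pit lam A T a d y t = {v} := by
  have src_eq : ∀ ν, (∀ i ≤ t, Yd lam A d ν i = y i) → srcX lam A ν t = v := by
    intro ν hν
    have hYt := hν t le_rfl
    rw [Yd_eq lam A d ν y t fun i hi => hν i hi.le, hv] at hYt
    split_ifs at hYt
    exact Option.some.inj hYt
  ext x
  constructor
  · rintro ⟨ν, -, hν, rfl⟩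
    exact src_eq ν hν
  · rintro rfl
    obtain ⟨ν, hbound, hν⟩ := hy
    have hν' : ∀ i ≤ t, Yd lam A d ν i = y i := fun i hi => hν i (hi.trans_lt ht)
    exact ⟨ν, hbound, hν', src_eq ν hν'⟩

theorem Pit_eq_sep_Theta (lam : ℝ) (A : Euc n ≃ₗᵢ[ℝ] Euc n) (T : ℕ) (a : ℕ → ℝ)
    (d : (t : ℕ) → (Fin t → Option (Euc n)) → Euc n → Bool) (y : ℕ → Option (Euc n))
    {t : ℕ} (hyt : y t = none) :
    Pit lam A T a d y t =
      {x ∈ Theta lam A T a d y t | d t (fun i => y i.1) x = false} := by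
  ext x
  constructor
  · rintro ⟨ν, hbound, hν, rfl⟩
    have hpast : ∀ i < t, Yd lam A d ν i = y i := fun i hi => hν i hi.le
    refine ⟨⟨ν, hbound, hpast, rfl⟩, ?_⟩
    have hYt := hν t le_rfl
    rw [Yd_eq lam A d ν y t hpast, hyt] at hYt
    simpa using hYt
  · rintro ⟨⟨ν, hbound, hpast, rfl⟩, hd⟩
    refine ⟨ν, hbound, fun i hi => ?_, rfl⟩
    rcases hi.lt_or_eq with hi | rfl
    · exact hpast i hi
    · simp [Yd_eq lam A d ν y i hpast, hd, hyt]

theorem Theta_succ (lam : ℝ) (A : Euc n ≃ₗᵢ[ℝ] Euc n) {T : ℕ} (a : ℕ → ℝ)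
    (d : (t : ℕ) → (Fin t → Option (Euc n)) → Euc n → Bool) (y : ℕ → Option (Euc n))
    {t : ℕ} (ht : t + 1 < T) :
    Theta lam A T a d y (t + 1) =
      {z | ∃ x ∈ Pit lam A T a d y t, ∃ w : Euc n, ‖w‖ ≤ a (t + 1) ∧
        z = lam • A x + w} := by
  ext z
  constructor
  · rintro ⟨ν, hbound, hν, rfl⟩
    exact ⟨srcX lam A ν t, ⟨ν, hbound, fun i hi => hν i (Nat.lt_succ_of_le hi), rfl⟩,
      ν (t + 1), hbound _ ht, rfl⟩
  · rintro ⟨-, ⟨ν, hbound, hν, rfl⟩, w, hw, rfl⟩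
    have hagree : ∀ i ≤ t, Function.update ν (t + 1) w i = ν i := fun i hi =>
      Function.update_of_ne (by omega) _ _
    refine ⟨Function.update ν (t + 1) w, fun i hi => ?_, fun i hi => ?_, ?_⟩
    · rcases eq_or_ne i (t + 1) with rfl | hne
      · rwa [Function.update_self]
      · rw [Function.update_of_ne hne]
        exact hbound i hi
    · have hit : i ≤ t := Nat.le_of_lt_succ hi
      rw [Yd_congr lam A d i fun j hj => hagree j (hj.trans hit)]
      exact hν i hit
    · rw [srcX, srcX_congr lam A hagree, Function.update_self]

/-- evolution of the conditional ranges.  Fix a prescription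
strategy `d` and a realizable observation sequence `y`.  Then (i) `Π_t = {y_t}`
if `y_t ≠ ε`, and `Π_t = {x ∈ Θ_t : Γ_t(x) = 0}` if `y_t = ε`, where
`Γ_t = d_t(y_{1:t−1})`; and (ii) for `t < T`,
`Θ_{t+1} = {λ A x + w : x ∈ Π_t, ‖w‖ ≤ a_{t+1}}`.  (All 0-indexed.) -/
theorem stmt3 {n : ℕ} (hn : 1 ≤ n) (lam : ℝ) (A : Euc n ≃ₗᵢ[ℝ] Euc n)
    (T K : ℕ) (hT : 1 ≤ T) (hK : 1 ≤ K) (hKT : K < T)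
    (a : ℕ → ℝ) (ha : ∀ t < T, 0 ≤ a t)
    (d : (t : ℕ) → (Fin t → Option (Euc n)) → Euc n → Bool)
    (y : ℕ → Option (Euc n))
    (hy : ∃ ν : ℕ → Euc n, (∀ i < T, ‖ν i‖ ≤ a i) ∧ ∀ i < T, Yd lam A d ν i = y i) :
    ∀ t < T,
      (∀ v : Euc n, y t = some v → Pit lam A T a d y t = {v}) ∧
      (y t = none →
        Pit lam A T a d y t =
          {x ∈ Theta lam A T a d y t | d t (fun i => y i.1) x = false}) ∧
      (t + 1 < T →
        Theta lam A T a d y (t + 1) =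
          {z | ∃ x ∈ Pit lam A T a d y t, ∃ w : Euc n, ‖w‖ ≤ a (t + 1) ∧
            z = lam • A x + w}) := by
  intro t ht
  exact ⟨fun _ hv => Pit_eq_singleton lam A hy ht hv,
    Pit_eq_sep_Theta lam A T a d y, Theta_succ lam A a d y⟩
end
end
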